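/- arXiv:1806.09706 — 4 statements merged into one kernel-verified Lean document; each statement's English description precedes it below -/
import Mathlib

section
/- Let f : ℝ² → ℂ be integrable and suppose the sliced Fourier transform ξ₁ ↦ 𝓕₂f(ξ₁, 0) is integrable on ℝ. Then the marginal f₂(x₁) = ∫_ℝ f(x₁, x₂) dx₂ satisfies, for almost every x₁ ∈ ℝ, f₂(x₁) = ∫_ℝ 𝓕₂f(ξ₁, 0) e^{2πi ξ₁ x₁} dξ₁ (inversion form of the Fourier slice theorem, Eq. 9b of the paper). -/
open MeasureTheory Real
open scoped FourierTransform RealInnerProductSpace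

/-- The point `(x, y)` of the Euclidean plane. -/
noncomputable def v2 (x y : ℝ) : EuclideanSpace ℝ (Fin 2) :=
  (WithLp.equiv 2 (Fin 2 → ℝ)).symm ![x, y]

section FourierInversion

variable {V : Type*} [NormedAddCommGroup V] [InnerProductSpace ℝ V] [FiniteDimensional ℝ V]
  [MeasurableSpace V] [BorelSpace V]

lemma integral_fourier_mul_eq_of_integrable {f g : V → ℂ} (hf : Integrable f)
    (hg : Integrable g) : ∫ ξ, 𝓕 f ξ * g ξ = ∫ x, f x * 𝓕 g x := by
  have h := VectorFourier.integral_fourierIntegral_smul_eq_flip (L := innerₗ V)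
    Real.continuous_fourierChar continuous_inner hf hg
  rw [flip_innerₗ] at h
  exact h

lemma integral_fourierInv_mul_eq_of_integrable {f g : V → ℂ} (hf : Integrable f)
    (hg : Integrable g) : ∫ ξ, 𝓕⁻ f ξ * g ξ = ∫ x, f x * 𝓕⁻ g x := by
  have h := integral_fourier_mul_eq_of_integrable hf hg.comp_neg
  rw [← fourierInv_eq_fourier_comp_neg, ← integral_neg_eq_self] at h
  simpa [fourierInv_eq_fourier_neg] using h

lemma continuous_fourierInv_of_integrable {f : V → ℂ} (hf : Integrable f) :
    Continuous (𝓕⁻ f) := by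
  have h : Continuous (𝓕 f) := VectorFourier.fourierIntegral_continuous
    Real.continuous_fourierChar continuous_inner hf
  have h2 : 𝓕⁻ f = fun x => 𝓕 f (-x) := funext fun x => fourierInv_eq_fourier_neg f x
  rw [h2]
  exact h.comp continuous_neg

/-- **Fourier inversion** almost everywhere, for an integrable function whose Fourier transform
is integrable. -/
theorem fourierInv_fourier_ae_eq {f : V → ℂ} (hf : Integrable f) (h'f : Integrable (𝓕 f)) :
    f =ᵐ[volume] 𝓕⁻ (𝓕 f) := by
  refine ae_eq_of_integral_contDiff_smul_eq hf.locallyIntegrable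
    (continuous_fourierInv_of_integrable h'f).locallyIntegrable fun g hg hgc => ?_
  have hgc' : HasCompactSupport (fun x => (g x : ℂ)) := hgc.comp_left Complex.ofReal_zero
  let φ : SchwartzMap V ℂ := hgc'.toSchwartzMap (Complex.ofRealCLM.contDiff.comp hg)
  have hφ : ∀ x, φ x = g x := fun x => rfl
  have h1 := integral_fourier_mul_eq_of_integrable hf (𝓕⁻ φ).integrable
  have h2 := integral_fourierInv_mul_eq_of_integrable h'f φ.integrable
  rw [← SchwartzMap.fourier_coe, FourierTransform.fourier_fourierInv_eq,
    SchwartzMap.fourierInv_coe, ← h2] at h1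
  simpa [hφ, mul_comm] using h1.symm

end FourierInversion

lemma v2_apply_zero (x y : ℝ) : v2 x y 0 = x := rfl

lemma v2_apply_one (x y : ℝ) : v2 x y 1 = y := rfl

lemma measurePreserving_v2 :
    MeasurePreserving (fun p : ℝ × ℝ => v2 p.1 p.2) volume volume :=
  (PiLp.volume_preserving_toLp (Fin 2)).comp (volume_preserving_finTwoArrow ℝ).symm

lemma measurableEmbedding_v2 : MeasurableEmbedding (fun p : ℝ × ℝ => v2 p.1 p.2) :=
  (MeasurableEquiv.toLp 2 (Fin 2 → ℝ)).measurableEmbedding.comp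
    (MeasurableEquiv.finTwoArrow (α := ℝ)).symm.measurableEmbedding

/-- **Fourier slice theorem**: the Fourier transform of the marginal is the slice of the planar
Fourier transform. -/
theorem fourier_marginal_eq_slice {f : EuclideanSpace ℝ (Fin 2) → ℂ} (hf : Integrable f) (ξ : ℝ) :
    𝓕 (fun x₁ : ℝ => ∫ x₂ : ℝ, f (v2 x₁ x₂)) ξ = 𝓕 f (v2 ξ 0) := by
  have hint : Integrable (fun v => 𝐞 (-⟪v, v2 ξ 0⟫) • f v) :=
    (Real.fourierIntegral_convergent_iff _).2 hf
  have hint' := (measurePreserving_v2.integrable_comp_emb measurableEmbedding_v2).2 hint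
  rw [Real.fourier_eq, Real.fourier_eq, ← measurePreserving_v2.integral_comp measurableEmbedding_v2]
  refine Eq.trans ?_ (integral_prod _ hint').symm
  refine integral_congr_ae (.of_forall fun x => ?_)
  simp only [Function.comp_apply, PiLp.inner_apply, Fin.sum_univ_two, v2_apply_zero,
    v2_apply_one, inner_zero_right, add_zero]
  simp only [Circle.smul_def, integral_smul]

/-- **Inversion form of the Fourier slice theorem in the plane.**
If `f : ℝ² → ℂ` is integrable and the slice `ξ₁ ↦ 𝓕 f (ξ₁, 0)` is integrable on `ℝ`,
then for a.e. `x₁`, the marginal `∫ x₂, f (x₁, x₂)` equals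
`∫ ξ₁, 𝓕 f (ξ₁, 0) e^{2πi ξ₁ x₁}`. -/
theorem fourier_slice_plane_inversion (f : EuclideanSpace ℝ (Fin 2) → ℂ)
    (hf : Integrable f)
    (hslice : Integrable fun ξ₁ : ℝ => 𝓕 f (v2 ξ₁ 0)) :
    ∀ᵐ x₁ : ℝ, (∫ x₂ : ℝ, f (v2 x₁ x₂)) =
      ∫ ξ₁ : ℝ, 𝓕 f (v2 ξ₁ 0) *
        Complex.exp (2 * (π : ℂ) * Complex.I * (ξ₁ : ℂ) * (x₁ : ℂ)) := by
  have hmarg : Integrable (fun x₁ : ℝ => ∫ x₂ : ℝ, f (v2 x₁ x₂)) :=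
    ((measurePreserving_v2.integrable_comp_emb measurableEmbedding_v2).2 hf).integral_prod_left
  have hF : 𝓕 (fun x₁ : ℝ => ∫ x₂ : ℝ, f (v2 x₁ x₂)) = fun ξ₁ => 𝓕 f (v2 ξ₁ 0) :=
    funext (fourier_marginal_eq_slice hf)
  filter_upwards [fourierInv_fourier_ae_eq hmarg (hF ▸ hslice)] with x hx
  rw [hx, hF, Real.fourierInv_eq']
  refine integral_congr_ae (.of_forall fun ξ => ?_)
  simp only [smul_eq_mul, mul_comm (Complex.exp _)]
  congr 2
  simp
  ring
end

section
/- Let f : ℝ² → ℂ be integrable, let ν ∈ ℝ² be a unit vector and set ν⊥ = (−ν₂, ν₁). Then the projection (P_ν f)(s) = ∫_ℝ f(s·ν⊥ + t·ν) dt is an integrable function of s ∈ ℝ, and its one-dimensional Fourier transform satisfies 𝓕₁(P_ν f)(σ) = 𝓕₂f(σ·ν⊥) for every σ ∈ ℝ (Fourier slice theorem in the plane for an arbitrary projection direction). -/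
open MeasureTheory Real
open scoped FourierTransform RealInnerProductSpace

/-- Orthonormal coordinates on a Euclidean plane, as a measurable equivalence
`(s, t) ↦ s • b 0 + t • b 1`. -/
noncomputable def OrthonormalBasis.planeMeasurableEquiv {F : Type*} [NormedAddCommGroup F]
    [InnerProductSpace ℝ F] [MeasurableSpace F] [BorelSpace F] [FiniteDimensional ℝ F]
    (b : OrthonormalBasis (Fin 2) ℝ F) : ℝ × ℝ ≃ᵐ F :=
  (MeasurableEquiv.finTwoArrow.symm.trans (MeasurableEquiv.toLp 2 (Fin 2 → ℝ))).trans
    b.measurableEquiv.symm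

section

variable {F : Type*} [NormedAddCommGroup F] [InnerProductSpace ℝ F] [MeasurableSpace F]
  [BorelSpace F] [FiniteDimensional ℝ F] (b : OrthonormalBasis (Fin 2) ℝ F)

theorem OrthonormalBasis.planeMeasurableEquiv_apply (p : ℝ × ℝ) :
    b.planeMeasurableEquiv p = p.1 • b 0 + p.2 • b 1 := by
  change b.repr.symm (WithLp.toLp 2 ![p.1, p.2]) = _
  simp [← b.sum_repr_symm, Fin.sum_univ_two]

theorem OrthonormalBasis.measurePreserving_planeMeasurableEquiv :
    MeasurePreserving b.planeMeasurableEquiv :=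
  ((volume_preserving_finTwoArrow ℝ).symm.trans
    (PiLp.volume_preserving_toLp (Fin 2))).trans b.measurePreserving_measurableEquiv.symm

theorem OrthonormalBasis.integrable_comp_plane {f : F → ℂ} (hf : Integrable f) :
    Integrable (fun p : ℝ × ℝ => f (p.1 • b 0 + p.2 • b 1)) := by
  simpa only [Function.comp_def, b.planeMeasurableEquiv_apply] using
    b.measurePreserving_planeMeasurableEquiv.integrable_comp_of_integrable hf

/-- Fubini's theorem in orthonormal coordinates of a Euclidean plane. -/
theorem OrthonormalBasis.integral_integral_plane {f : F → ℂ} (hf : Integrable f) :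
    ∫ s : ℝ, ∫ t : ℝ, f (s • b 0 + t • b 1) = ∫ x, f x := by
  rw [integral_integral (f := fun s t => f (s • b 0 + t • b 1)) (b.integrable_comp_plane hf),
    ← b.measurePreserving_planeMeasurableEquiv.integral_comp']
  simp only [b.planeMeasurableEquiv_apply, Measure.volume_eq_prod]

theorem OrthonormalBasis.integrable_integral_line {f : F → ℂ} (hf : Integrable f) :
    Integrable (fun s : ℝ => ∫ t : ℝ, f (s • b 0 + t • b 1)) :=
  (b.integrable_comp_plane hf).integral_prod_left

/-- The Fourier slice theorem in orthonormal coordinates of a Euclidean plane. -/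
theorem OrthonormalBasis.fourier_integral_line {f : F → ℂ} (hf : Integrable f) (σ : ℝ) :
    𝓕 (fun s : ℝ => ∫ t : ℝ, f (s • b 0 + t • b 1)) σ = 𝓕 f (σ • b 0) := by
  rw [Real.fourier_eq, Real.fourier_eq,
    ← b.integral_integral_plane ((Real.fourierIntegral_convergent_iff (σ • b 0)).2 hf)]
  congr 1 with s
  rw [Circle.smul_def, ← integral_smul]
  congr 1 with t
  simp [inner_add_left, inner_smul_left, inner_smul_right, Circle.smul_def]

end

theorem orthonormal_v2_rotation {ν : EuclideanSpace ℝ (Fin 2)} (hν : ‖ν‖ = 1) :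
    Orthonormal ℝ ![v2 (-(ν 1)) (ν 0), ν] := by
  have h : ν 0 ^ 2 + ν 1 ^ 2 = 1 := by
    rw [← Fin.sum_univ_two (fun i => ν i ^ 2), ← EuclideanSpace.real_norm_sq_eq, hν, one_pow]
  have hv : ‖v2 (-(ν 1)) (ν 0)‖ = 1 := by
    simp [v2, EuclideanSpace.norm_eq, Fin.sum_univ_two, add_comm, h]
  have hi : ⟪v2 (-(ν 1)) (ν 0), ν⟫ = 0 := by
    simp [v2, PiLp.inner_apply, Fin.sum_univ_two, mul_comm]
  exact orthonormal_vecCons_iff.2 ⟨hv, by simpa [Fin.forall_fin_one] using hi,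
    by simpa [orthonormal_vecCons_iff, Orthonormal] using hν⟩

/-- **Fourier slice theorem in the plane for an arbitrary projection direction.**
For integrable `f : ℝ² → ℂ` and a unit vector `ν` with `ν⊥ = (-ν₂, ν₁)`, the projection
`(P_ν f) s = ∫ t, f (s • ν⊥ + t • ν)` is integrable on `ℝ` and
`𝓕 (P_ν f) σ = 𝓕 f (σ • ν⊥)` for every `σ`. -/
theorem fourier_slice_plane_general (f : EuclideanSpace ℝ (Fin 2) → ℂ)
    (hf : Integrable f) (ν : EuclideanSpace ℝ (Fin 2)) (hν : ‖ν‖ = 1) :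
    Integrable (fun s : ℝ => ∫ t : ℝ, f (s • v2 (-(ν 1)) (ν 0) + t • ν)) ∧
    ∀ σ : ℝ, 𝓕 (fun s : ℝ => ∫ t : ℝ, f (s • v2 (-(ν 1)) (ν 0) + t • ν)) σ =
      𝓕 f (σ • v2 (-(ν 1)) (ν 0)) := by
  obtain ⟨b, hb⟩ : ∃ b : OrthonormalBasis (Fin 2) ℝ (EuclideanSpace ℝ (Fin 2)),
      ⇑b = ![v2 (-(ν 1)) (ν 0), ν] :=
    ⟨(basisOfOrthonormalOfCardEqFinrank (orthonormal_v2_rotation hν)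
      (by simp)).toOrthonormalBasis (by simpa using orthonormal_v2_rotation hν), by simp⟩
  have h0 : b 0 = v2 (-(ν 1)) (ν 0) := by simp [hb]
  have h1 : b 1 = ν := by simp [hb]
  rw [← h0]
  have hI := b.integrable_integral_line hf
  have hF := b.fourier_integral_line hf
  rw [h1] at hI hF
  exact ⟨hI, hF⟩
end

section
/- Let f : ℝ³ → ℂ be integrable, let ν ∈ ℝ³ be a unit vector, and let u : ℝ² → ℝ³ be a linear isometry whose range is the orthogonal complement of ν. Then the projection g(y) = ∫_ℝ f(u(y) + t·ν) dt is an integrable function on ℝ², and its two-dimensional Fourier transform satisfies 𝓕₂g(η) = 𝓕₃f(u(η)) for every η ∈ ℝ² (X-ray Fourier slice theorem in space for an arbitrary projection direction, underlying Proposition 2 of the paper). -/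
open MeasureTheory Real
open scoped FourierTransform RealInnerProductSpace

/-- A linear isometry onto the orthogonal complement of a unit vector `ν` extends to a surjective
isometry `(y, t) ↦ u y + t • ν` on the `L²` product with `ℝ`, so this map preserves volume. -/
theorem measurePreserving_isometry_add_smul {E F : Type*}
    [NormedAddCommGroup E] [InnerProductSpace ℝ E] [FiniteDimensional ℝ E]
    [MeasurableSpace E] [BorelSpace E]
    [NormedAddCommGroup F] [InnerProductSpace ℝ F] [FiniteDimensional ℝ F]
    [MeasurableSpace F] [BorelSpace F]
    (u : E →ₗᵢ[ℝ] F) {ν : F} (hν : ‖ν‖ = 1)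
    (hu : LinearMap.range u.toLinearMap = (Submodule.span ℝ {ν})ᗮ) :
    MeasurePreserving (fun p : E × ℝ => u p.1 + p.2 • ν) ∧
      MeasurableEmbedding (fun p : E × ℝ => u p.1 + p.2 • ν) := by
  have horth (y : E) : ⟪u y, ν⟫ = 0 := by
    have hy : u y ∈ (Submodule.span ℝ {ν})ᗮ := hu ▸ LinearMap.mem_range_self u.toLinearMap y
    exact Submodule.mem_orthogonal_singleton_iff_inner_left.1 hy
  let L : WithLp 2 (E × ℝ) →ₗ[ℝ] F :=
    (u.toLinearMap.coprod (LinearMap.toSpanSingleton ℝ F ν)) ∘ₗ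
      (WithLp.linearEquiv 2 ℝ (E × ℝ)).toLinearMap
  have hL (p : WithLp 2 (E × ℝ)) : L p = u p.fst + p.snd • ν := rfl
  have hnorm (p : WithLp 2 (E × ℝ)) : ‖L p‖ = ‖p‖ := by
    rw [← sq_eq_sq₀ (norm_nonneg _) (norm_nonneg _), hL, WithLp.prod_norm_sq_eq_of_L2,
      norm_add_sq_real, inner_smul_right, horth, norm_smul, hν, u.norm_map]
    ring
  have hsurj : Function.Surjective L := fun w => by
    have hw : w - ⟪ν, w⟫ • ν ∈ LinearMap.range u.toLinearMap := by
      rw [hu, Submodule.mem_orthogonal_singleton_iff_inner_right, inner_sub_right,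
        inner_smul_right, real_inner_self_eq_norm_sq, hν]
      ring
    obtain ⟨y, hy⟩ := hw
    replace hy : u y = w - ⟪ν, w⟫ • ν := hy
    exact ⟨WithLp.toLp 2 (y, ⟪ν, w⟫), by simp [hL, hy]⟩
  let e : WithLp 2 (E × ℝ) ≃ₗᵢ[ℝ] F := LinearIsometryEquiv.ofSurjective ⟨L, hnorm⟩ hsurj
  exact ⟨e.measurePreserving.comp (WithLp.volume_preserving_toLp E ℝ),
    e.toMeasurableEquiv.measurableEmbedding.comp
      (MeasurableEquiv.toLp 2 (E × ℝ)).measurableEmbedding⟩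


/-- **X-ray Fourier slice theorem in space for an arbitrary projection direction.**
Let `f : ℝ³ → ℂ` be integrable, `ν` a unit vector and `u : ℝ² →ₗᵢ ℝ³` a linear isometry
whose range is the orthogonal complement of `ν`.  Then `g y = ∫ t, f (u y + t • ν)` is
integrable on `ℝ²` and `𝓕 g η = 𝓕 f (u η)` for every `η`. -/
theorem fourier_slice_space_xray_general (f : EuclideanSpace ℝ (Fin 3) → ℂ)
    (hf : Integrable f) (ν : EuclideanSpace ℝ (Fin 3)) (hν : ‖ν‖ = 1)
    (u : EuclideanSpace ℝ (Fin 2) →ₗᵢ[ℝ] EuclideanSpace ℝ (Fin 3))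
    (hu : LinearMap.range u.toLinearMap = (Submodule.span ℝ {ν})ᗮ) :
    Integrable (fun y : EuclideanSpace ℝ (Fin 2) => ∫ t : ℝ, f (u y + t • ν)) ∧
    ∀ η : EuclideanSpace ℝ (Fin 2),
      𝓕 (fun y : EuclideanSpace ℝ (Fin 2) => ∫ t : ℝ, f (u y + t • ν)) η = 𝓕 f (u η) := by
  obtain ⟨hmp, hemb⟩ := measurePreserving_isometry_add_smul u hν hu
  have hf_slice : Integrable (fun p : EuclideanSpace ℝ (Fin 2) × ℝ => f (u p.1 + p.2 • ν)) :=
    (hmp.integrable_comp_emb hemb).2 hf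
  refine ⟨hf_slice.integral_prod_left, fun η => ?_⟩
  have horth : ⟪ν, u η⟫ = 0 := by
    have hη : u η ∈ (Submodule.span ℝ {ν})ᗮ := hu ▸ LinearMap.mem_range_self u.toLinearMap η
    exact Submodule.mem_orthogonal_singleton_iff_inner_right.1 hη
  have hphase (p : EuclideanSpace ℝ (Fin 2) × ℝ) : ⟪u p.1 + p.2 • ν, u η⟫ = ⟪p.1, η⟫ := by
    rw [inner_add_left, inner_smul_left, horth, mul_zero, add_zero, u.inner_map_map]
  have hf_phase : Integrable (fun p : EuclideanSpace ℝ (Fin 2) × ℝ =>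
      𝐞 (-⟪p.1, η⟫) • f (u p.1 + p.2 • ν)) := by
    have h := (hmp.integrable_comp_emb hemb).2 ((Real.fourierIntegral_convergent_iff (u η)).2 hf)
    simpa only [Function.comp_def, hphase] using h
  rw [Real.fourier_eq, Real.fourier_eq, ← hmp.integral_comp hemb]
  simp only [hphase]
  rw [Measure.volume_eq_prod, integral_prod _ hf_phase]
  simp only [Circle.smul_def, integral_smul]
end

section
/- Let f : ℝ³ → ℂ be integrable, let ν ∈ ℝ³ be a unit vector, and let u : ℝ² → ℝ³ be a linear isometry whose range is the orthogonal complement of ν. Then the projection onto the line ℝν, g(s) = ∫_{ℝ²} f(s·ν + u(y)) dy, is an integrable function on ℝ, and its one-dimensional Fourier transform satisfies 𝓕₁g(σ) = 𝓕₃f(σ·ν) for every σ ∈ ℝ (Fourier slice theorem for projection along two dimensions in an arbitrary direction, underlying Proposition 3 of the paper). -/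
open MeasureTheory Real
open scoped FourierTransform RealInnerProductSpace

section FourierSlice

variable {E F : Type*} [NormedAddCommGroup E] [InnerProductSpace ℝ E] [FiniteDimensional ℝ E]
  [NormedAddCommGroup F] [InnerProductSpace ℝ F] [FiniteDimensional ℝ F]

/-- If `ν` is a unit vector orthogonal to the range of an isometry `u` of codimension one, then
`(s, y) ↦ s • ν + u y` is an isometric isomorphism from the `L²` product. -/
theorem exists_linearIsometryEquiv_smul_add (hd : Module.finrank ℝ F = Module.finrank ℝ E + 1)
    {ν : F} (hν : ‖ν‖ = 1) (u : E →ₗᵢ[ℝ] F) (hu : ∀ y, ⟪ν, u y⟫ = 0) :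
    ∃ e : WithLp 2 (ℝ × E) ≃ₗᵢ[ℝ] F, ∀ p, e p = p.fst • ν + u p.snd := by
  let T : WithLp 2 (ℝ × E) →ₗ[ℝ] F :=
    ((LinearMap.toSpanSingleton ℝ F ν).coprod u.toLinearMap) ∘ₗ
      (WithLp.linearEquiv 2 ℝ (ℝ × E)).toLinearMap
  have hT : ∀ p, T p = p.fst • ν + u p.snd := fun p ↦ rfl
  have hnorm : ∀ p, ‖T p‖ = ‖p‖ := fun p ↦ by
    have h : ⟪p.fst • ν, u p.snd⟫ = 0 := by rw [real_inner_smul_left, hu, mul_zero]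
    rw [← sq_eq_sq₀ (norm_nonneg _) (norm_nonneg _), WithLp.prod_norm_sq_eq_of_L2, hT, sq,
      norm_add_sq_eq_norm_sq_add_norm_sq_real h, norm_smul, hν, u.norm_map]
    ring
  have hfin : Module.finrank ℝ (WithLp 2 (ℝ × E)) = Module.finrank ℝ F := by
    rw [(WithLp.linearEquiv 2 ℝ (ℝ × E)).finrank_eq, Module.finrank_prod, Module.finrank_self, hd,
      add_comm]
  exact ⟨LinearIsometry.toLinearIsometryEquiv ⟨T, hnorm⟩ hfin, fun p ↦ hT p⟩

variable [MeasurableSpace E] [BorelSpace E] [MeasurableSpace F] [BorelSpace F]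

/-- Lebesgue measure splits along a unit vector and an isometric parametrization of its orthogonal
complement. -/
theorem exists_measurePreserving_smul_add (hd : Module.finrank ℝ F = Module.finrank ℝ E + 1)
    {ν : F} (hν : ‖ν‖ = 1) (u : E →ₗᵢ[ℝ] F) (hu : ∀ y, ⟪ν, u y⟫ = 0) :
    ∃ e : ℝ × E ≃ᵐ F, MeasurePreserving e ∧ ∀ p, e p = p.1 • ν + u p.2 := by
  obtain ⟨e, he⟩ := exists_linearIsometryEquiv_smul_add hd hν u hu
  refine ⟨(MeasurableEquiv.toLp 2 (ℝ × E)).trans e.toMeasurableEquiv, ?_, fun p ↦ he _⟩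
  exact e.measurePreserving.comp (WithLp.volume_preserving_toLp ℝ E)

/-- Fourier slice theorem for projection onto the line spanned by a unit vector. -/
theorem integrable_integral_smul_add_and_fourier_eq
    {G : Type*} [NormedAddCommGroup G] [NormedSpace ℂ G]
    (hd : Module.finrank ℝ F = Module.finrank ℝ E + 1) {f : F → G} (hf : Integrable f)
    {ν : F} (hν : ‖ν‖ = 1) (u : E →ₗᵢ[ℝ] F) (hu : ∀ y, ⟪ν, u y⟫ = 0) :
    Integrable (fun s : ℝ ↦ ∫ y, f (s • ν + u y)) ∧
      ∀ σ : ℝ, 𝓕 (fun s : ℝ ↦ ∫ y, f (s • ν + u y)) σ = 𝓕 f (σ • ν) := by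
  obtain ⟨e, hmp, he⟩ := exists_measurePreserving_smul_add hd hν u hu
  have integrable_comp {h : F → G} (hh : Integrable h) :
      Integrable (fun p : ℝ × E ↦ h (p.1 • ν + u p.2)) (volume.prod volume) := by
    simpa only [Function.comp_def, he, Measure.volume_eq_prod] using
      (hmp.integrable_comp_emb e.measurableEmbedding).2 hh
  refine ⟨(integrable_comp hf).integral_prod_left, fun σ ↦ ?_⟩
  have hint : Integrable (fun x ↦ 𝐞 (-⟪x, σ • ν⟫) • f x) :=
    (Real.fourierIntegral_convergent_iff (σ • ν)).2 hf
  rw [Real.fourier_eq, Real.fourier_eq, ← hmp.integral_comp', Measure.volume_eq_prod]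
  simp_rw [he]
  rw [integral_prod _ (integrable_comp hint)]
  congr 1 with s
  have h (y : E) : ⟪s • ν + u y, σ • ν⟫ = ⟪s, σ⟫ := by
    rw [inner_add_left, real_inner_smul_left, real_inner_smul_right, real_inner_smul_right,
      real_inner_self_eq_norm_sq, hν, real_inner_comm, hu]
    simp [mul_comm]
  simp only [h, Circle.smul_def, integral_smul]

end FourierSlice

/-- **Fourier slice theorem for projection along two dimensions in an arbitrary direction.**
Let `f : ℝ³ → ℂ` be integrable, `ν` a unit vector and `u : ℝ² →ₗᵢ ℝ³` a linear isometry
whose range is the orthogonal complement of `ν`.  Then the projection onto the line `ℝν`,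
`g s = ∫_{ℝ²} f (s • ν + u y) dy`, is integrable on `ℝ` and `𝓕 g σ = 𝓕 f (σ • ν)`
for every `σ`. -/
theorem fourier_slice_space_to_line (f : EuclideanSpace ℝ (Fin 3) → ℂ)
    (hf : Integrable f) (ν : EuclideanSpace ℝ (Fin 3)) (hν : ‖ν‖ = 1)
    (u : EuclideanSpace ℝ (Fin 2) →ₗᵢ[ℝ] EuclideanSpace ℝ (Fin 3))
    (hu : LinearMap.range u.toLinearMap = (Submodule.span ℝ {ν})ᗮ) :
    Integrable (fun s : ℝ => ∫ y : EuclideanSpace ℝ (Fin 2), f (s • ν + u y)) ∧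
    ∀ σ : ℝ,
      𝓕 (fun s : ℝ => ∫ y : EuclideanSpace ℝ (Fin 2), f (s • ν + u y)) σ = 𝓕 f (σ • ν) := by
  refine integrable_integral_smul_add_and_fourier_eq (by simp) hf hν u fun y ↦ ?_
  have hy : u y ∈ (Submodule.span ℝ {ν})ᗮ := hu ▸ LinearMap.mem_range_self u.toLinearMap y
  exact Submodule.mem_orthogonal_singleton_iff_inner_right.1 hy
end
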